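/- arXiv:2601.16201 — 2 statements merged into one kernel-verified Lean document; each statement's English description precedes it below -/
import Mathlib

section
/- Let A be a ring and let S be a simple right A-module that is not singular (i.e., Sing S ≠ S). Then there exist a two-sided ideal B of A and a closed right ideal C of A such that B ∩ C = 0, B ⊕ C = B + C is an essential right ideal of A, CB = 0, and B, viewed as a right A-module, is nonzero, non-singular, semisimple, and isomorphic to a direct sum of copies of the simple module S. -/
open MulOpposite DirectSum

/-- A module `M` over a ring `R` is *bassian* if for every submodule `N` of `M`,
the existence of an injective `R`-linear map `M → M/N` implies `N = 0`.
(A right `A`-module is formalized as a module over the opposite ring `Aᵐᵒᵖ`.) -/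
def IsBassian (R : Type*) [Ring R] (M : Type*) [AddCommGroup M] [Module R M] : Prop :=
  ∀ N : Submodule R M, (∃ f : M →ₗ[R] M ⧸ N, Function.Injective f) → N = ⊥

/-- A module `M` over a ring `R` is *generalized bassian* if for every submodule `N` of `M`,
the existence of an injective `R`-linear map `M → M/N` implies that `N` is a direct summand
of `M`. -/
def IsGeneralizedBassian (R : Type*) [Ring R] (M : Type*) [AddCommGroup M] [Module R M] : Prop :=
  ∀ N : Submodule R M, (∃ f : M →ₗ[R] M ⧸ N, Function.Injective f) →
    ∃ N' : Submodule R M, IsCompl N N'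


/-- A submodule `N` of `M` is *essential* if it intersects every nonzero submodule
of `M` nontrivially. -/
def IsEssentialSubmodule {R M : Type*} [Ring R] [AddCommGroup M] [Module R M]
    (N : Submodule R M) : Prop :=
  ∀ Y : Submodule R M, Y ≠ ⊥ → N ⊓ Y ≠ ⊥

/-- The right annihilator of an element `m` of a right `A`-module `M`
(i.e. a module over `Aᵐᵒᵖ`), as a right ideal of `A` (i.e. an `Aᵐᵒᵖ`-submodule of `A`). -/
def rightAnnihilator (A : Type*) [Ring A] {M : Type*} [AddCommGroup M] [Module Aᵐᵒᵖ M]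
    (m : M) : Submodule Aᵐᵒᵖ A where
  carrier := {a : A | op a • m = 0}
  add_mem' := by
    intro a b ha hb
    simp only [Set.mem_setOf_eq] at *
    rw [op_add, add_smul, ha, hb, add_zero]
  zero_mem' := by simp
  smul_mem' := by
    intro c a ha
    simp only [Set.mem_setOf_eq] at *
    have : op (c • a) = c * op a := by
      induction c using MulOpposite.rec' with
      | h x => rw [op_smul_eq_mul]; rfl
    rw [this, mul_smul, ha, smul_zero]

/-- The singular set `Sing M` of a right `A`-module `M`: the set of all `m ∈ M` whose right
annihilator is an essential right ideal of `A`. -/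
def singularSet (A : Type*) [Ring A] (M : Type*) [AddCommGroup M] [Module Aᵐᵒᵖ M] : Set M :=
  {m : M | IsEssentialSubmodule (rightAnnihilator A m)}

/-- A submodule `C` of `M` is *closed* in `M` if `C` has no proper essential extensions
in `M`. -/
def IsClosedSubmodule {R M : Type*} [Ring R] [AddCommGroup M] [Module R M]
    (C : Submodule R M) : Prop :=
  ∀ D : Submodule R M, C ≤ D → (∀ Y : Submodule R M, Y ≤ D → Y ≠ ⊥ → C ⊓ Y ≠ ⊥) → C = D

theorem IsEssentialSubmodule.mono {R M : Type*} [Ring R] [AddCommGroup M] [Module R M]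
    {N P : Submodule R M} (hN : IsEssentialSubmodule N) (h : N ≤ P) : IsEssentialSubmodule P :=
  fun Y hY hPY ↦ hN Y hY <| le_bot_iff.mp <| (inf_le_inf_right Y h).trans hPY.le

theorem IsEssentialSubmodule.comap {R M N : Type*} [Ring R] [AddCommGroup M] [Module R M]
    [AddCommGroup N] [Module R N] {P : Submodule R N} (hP : IsEssentialSubmodule P)
    (f : M →ₗ[R] N) : IsEssentialSubmodule (P.comap f) := by
  intro Y hY h
  by_cases hf : Y.map f = ⊥
  · refine hY ?_
    rw [← inf_eq_right.mpr ((Submodule.map_le_iff_le_comap.mp (hf.le.trans bot_le) :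
      Y ≤ P.comap f)), h]
  · obtain ⟨x, ⟨hxP, y, hy, rfl⟩, hx⟩ := Submodule.exists_mem_ne_zero_of_ne_bot (hP _ hf)
    have hy0 : y ∈ P.comap f ⊓ Y := ⟨hxP, hy⟩
    rw [h, Submodule.mem_bot] at hy0
    exact hx (by rw [hy0, map_zero])

theorem mem_rightAnnihilator {A M : Type*} [Ring A] [AddCommGroup M] [Module Aᵐᵒᵖ M] {m : M}
    {a : A} : a ∈ rightAnnihilator A m ↔ op a • m = 0 :=
  Iff.rfl

theorem zero_mem_singularSet (A M : Type*) [Ring A] [AddCommGroup M] [Module Aᵐᵒᵖ M] :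
    (0 : M) ∈ singularSet A M := by
  intro Y hY
  have : rightAnnihilator A (0 : M) = ⊤ :=
    eq_top_iff.mpr fun a _ ↦ mem_rightAnnihilator.mpr (smul_zero _)
  rwa [this, top_inf_eq]

theorem smul_mem_singularSet {A M : Type*} [Ring A] [AddCommGroup M] [Module Aᵐᵒᵖ M] {m : M}
    (hm : m ∈ singularSet A M) (r : Aᵐᵒᵖ) : r • m ∈ singularSet A M := by
  refine (IsEssentialSubmodule.comap hm (DistribSMul.toLinearMap Aᵐᵒᵖ A r.unop)).mono fun a ha ↦ ?_
  rw [Submodule.mem_comap, DistribSMul.toLinearMap_apply, mem_rightAnnihilator, smul_eq_mul,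
    op_mul, op_unop, mul_smul] at ha
  exact ha

theorem map_mem_singularSet {A M N : Type*} [Ring A] [AddCommGroup M] [Module Aᵐᵒᵖ M]
    [AddCommGroup N] [Module Aᵐᵒᵖ N] (f : M →ₗ[Aᵐᵒᵖ] N) {m : M} (hm : m ∈ singularSet A M) :
    f m ∈ singularSet A N := by
  refine IsEssentialSubmodule.mono hm fun a ha ↦ ?_
  rw [mem_rightAnnihilator] at ha ⊢
  rw [← map_smul, ha, map_zero]

theorem singularSet_eq_zero_of_ne_univ {A S : Type*} [Ring A] [AddCommGroup S] [Module Aᵐᵒᵖ S]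
    [IsSimpleModule Aᵐᵒᵖ S] (hS : singularSet A S ≠ Set.univ) : singularSet A S = {0} := by
  refine Set.Subset.antisymm (fun s hs ↦ ?_)
    (Set.singleton_subset_iff.mpr (zero_mem_singularSet A S))
  by_contra hs0
  refine hS (Set.eq_univ_of_forall fun t ↦ ?_)
  obtain ⟨r, rfl⟩ := IsSimpleModule.toSpanSingleton_surjective Aᵐᵒᵖ hs0 t
  exact smul_mem_singularSet hs r

theorem singularSet_finsupp_eq_zero {A S ι : Type*} [Ring A] [AddCommGroup S] [Module Aᵐᵒᵖ S]
    (hS : singularSet A S = {0}) : singularSet A (ι →₀ S) = {0} := by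
  refine Set.Subset.antisymm (fun x hx ↦ Finsupp.ext fun i ↦ ?_)
    (Set.singleton_subset_iff.mpr (zero_mem_singularSet A _))
  have := map_mem_singularSet (Finsupp.lapply i) hx
  rwa [hS] at this

theorem singularSet_eq_zero_of_injective {A M N : Type*} [Ring A] [AddCommGroup M]
    [Module Aᵐᵒᵖ M] [AddCommGroup N] [Module Aᵐᵒᵖ N] (f : M →ₗ[Aᵐᵒᵖ] N)
    (hf : Function.Injective f) (hN : singularSet A N = {0}) : singularSet A M = {0} := by
  refine Set.Subset.antisymm (fun x hx ↦ hf ?_)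
    (Set.singleton_subset_iff.mpr (zero_mem_singularSet A M))
  have := map_mem_singularSet f hx
  rw [hN, Set.mem_singleton_iff] at this
  rw [this, map_zero]

/-- A simple module that is not singular is isomorphic to a right ideal. -/
theorem exists_linearEquiv_rightIdeal_of_singularSet_ne_univ {A S : Type*} [Ring A]
    [AddCommGroup S] [Module Aᵐᵒᵖ S] [IsSimpleModule Aᵐᵒᵖ S]
    (hS : singularSet A S ≠ Set.univ) :
    ∃ Y : Submodule Aᵐᵒᵖ A, Nonempty (Y ≃ₗ[Aᵐᵒᵖ] S) := by
  obtain ⟨s, hs⟩ := (Set.ne_univ_iff_exists_notMem _).mp hS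
  obtain ⟨Y, hY, hsY⟩ : ∃ Y : Submodule Aᵐᵒᵖ A, Y ≠ ⊥ ∧ rightAnnihilator A s ⊓ Y = ⊥ := by
    simpa [singularSet, IsEssentialSubmodule] using hs
  let f : Y →ₗ[Aᵐᵒᵖ] S :=
    { toFun := fun y ↦ op (y : A) • s
      map_add' := fun x y ↦ by simp [add_smul]
      map_smul' := fun r y ↦ by
        rw [RingHom.id_apply, ← mul_smul, Submodule.coe_smul]
        rfl }
  have hf : Function.Injective f := by
    refine (injective_iff_map_eq_zero f).mpr fun y hy ↦ ?_
    have : (y : A) ∈ rightAnnihilator A s ⊓ Y := ⟨hy, y.2⟩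
    rw [hsY, Submodule.mem_bot] at this
    exact Subtype.ext this
  have : Nontrivial Y := Submodule.nontrivial_iff_ne_bot.mpr hY
  have hf0 : f ≠ 0 := by
    rintro h
    obtain ⟨y, hy⟩ := exists_ne (0 : Y)
    exact hy (hf (by rw [h, LinearMap.zero_apply, LinearMap.zero_apply]))
  exact ⟨Y, ⟨LinearEquiv.ofBijective f ⟨hf, LinearMap.surjective_of_ne_zero hf0⟩⟩⟩

theorem exists_maximal_disjoint_submodule {R M : Type*} [Ring R] [AddCommGroup M] [Module R M]
    (B : Submodule R M) : ∃ C, Maximal (Disjoint B) C := by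
  obtain ⟨C, -, hC⟩ := zorn_le_nonempty₀ {C | Disjoint B C}
    (fun c hc hchain _ _ ↦ ⟨sSup c, hchain.directedOn.disjoint_sSup_right.mpr hc,
      fun _ ↦ le_sSup⟩) ⊥ disjoint_bot_right
  exact ⟨C, hC⟩

theorem isClosedSubmodule_of_maximal_disjoint {R M : Type*} [Ring R] [AddCommGroup M]
    [Module R M] {B C : Submodule R M} (hC : Maximal (Disjoint B) C) : IsClosedSubmodule C := by
  intro D hCD hD
  refine hC.eq_of_le (disjoint_iff.mpr ?_) hCD
  by_contra hBD
  exact hD _ inf_le_right hBD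
    (le_bot_iff.mp ((le_inf (inf_le_right.trans inf_le_left) inf_le_left).trans
      hC.prop.eq_bot.le))

theorem isEssentialSubmodule_sup_of_maximal_disjoint {R M : Type*} [Ring R] [AddCommGroup M]
    [Module R M] {B C : Submodule R M} (hC : Maximal (Disjoint B) C) :
    IsEssentialSubmodule (B ⊔ C) := by
  intro Y hY h
  have hYC : Y ≤ C := le_sup_right.trans <| hC.le_of_ge
    (hC.prop.disjoint_sup_right_of_disjoint_sup_left (disjoint_iff.mpr h)) le_sup_left
  rw [inf_eq_right.mpr (hYC.trans le_sup_right)] at h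
  exact hY h

/-- If `S` is a simple right `A`-module that is not singular, then there are a two-sided
ideal `B` and a closed right ideal `C` of `A` with `B ∩ C = 0`, `B ⊕ C` essential in `A`,
`CB = 0`, and `B` a nonzero non-singular semisimple right `A`-module isomorphic to a
direct sum of copies of `S`. -/
theorem stmt9 {A : Type u} [Ring A] (S : Type v) [AddCommGroup S] [Module Aᵐᵒᵖ S]
    [IsSimpleModule Aᵐᵒᵖ S] (hS : singularSet A S ≠ Set.univ) :
    ∃ B C : Submodule Aᵐᵒᵖ A,
      (∀ x : A, ∀ b ∈ B, x * b ∈ B) ∧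
      IsClosedSubmodule C ∧
      B ⊓ C = ⊥ ∧
      IsEssentialSubmodule (B ⊔ C) ∧
      (∀ c ∈ C, ∀ b ∈ B, c * b = 0) ∧
      B ≠ ⊥ ∧
      singularSet A ↥B = {0} ∧
      IsSemisimpleModule Aᵐᵒᵖ ↥B ∧
      ∃ ι : Type u, Nonempty (↥B ≃ₗ[Aᵐᵒᵖ] (ι →₀ S)) := by
  obtain ⟨Y, ⟨e⟩⟩ := exists_linearEquiv_rightIdeal_of_singularSet_ne_univ hS
  let B := isotypicComponent Aᵐᵒᵖ A S
  have hB : ∀ x : A, ∀ b ∈ B, x * b ∈ B := fun x b hb ↦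
    LinearMap.le_comap_isotypicComponent S (DistribSMul.toLinearMap Aᵐᵒᵖ A x) hb
  obtain ⟨C, hC⟩ := exists_maximal_disjoint_submodule B
  obtain ⟨ι, ⟨f⟩⟩ := (IsIsotypicOfType.isotypicComponent Aᵐᵒᵖ A S).linearEquiv_finsupp
  refine ⟨B, C, hB, isClosedSubmodule_of_maximal_disjoint hC, hC.prop.eq_bot,
    isEssentialSubmodule_sup_of_maximal_disjoint hC, fun c hc b hb ↦ ?_, ?_,
    singularSet_eq_zero_of_injective f.toLinearMap f.injective
      (singularSet_finsupp_eq_zero (singularSet_eq_zero_of_ne_univ hS)),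
    inferInstanceAs (IsSemisimpleModule Aᵐᵒᵖ (isotypicComponent Aᵐᵒᵖ A S)), ι, ⟨f⟩⟩
  · exact Submodule.disjoint_def.mp hC.prop _ (hB c b hb) (C.smul_mem (op b) hc)
  · have := IsSimpleModule.congr e
    rw [show B = isotypicComponent Aᵐᵒᵖ A Y from e.isotypicComponent_eq.symm]
    exact (bot_lt_isotypicComponent Y).ne'
end

section
/- Let A be a prime ring which is right finite-dimensional (the right A-module A contains no infinite direct sums of nonzero right ideals) and which is not right artinian. Then every generalized bassian non-singular right A-module M (i.e., with Sing M = 0) is a bassian right A-module. -/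
open MulOpposite DirectSum

/-- The linear map `A → M`, `a ↦ m a`, attached to an element `m` of a right `A`-module `M`. -/
def orbitMap {A : Type*} [Ring A] {M : Type*} [AddCommGroup M] [Module Aᵐᵒᵖ M] (m : M) :
    A →ₗ[Aᵐᵒᵖ] M where
  toFun a := op a • m
  map_add' a b := by rw [op_add, add_smul]
  map_smul' c a := by
    have : op (c • a) = c * op a := rfl
    rw [this, mul_smul, RingHom.id_apply]

/-- If `M` embeds in `M ⧸ N` and `M` is generalized bassian, then every submodule of `N` is a
direct summand of `M`, so that `N` is semisimple. -/
theorem IsGeneralizedBassian.isSemisimpleModule {R M : Type*} [Ring R] [AddCommGroup M]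
    [Module R M] (hM : IsGeneralizedBassian R M) {N : Submodule R M} {f : M →ₗ[R] M ⧸ N}
    (hf : Function.Injective f) : IsSemisimpleModule R N := by
  obtain ⟨N', hN⟩ := hM N ⟨f, hf⟩
  rw [isSemisimpleModule_iff]
  refine ⟨fun p ↦ ?_⟩
  have hK : p.map N.subtype ≤ N := N.map_subtype_le p
  have hg : Function.Injective ((p.map N.subtype).mkQ ∘ₗ N'.subtype) := by
    rw [← LinearMap.ker_eq_bot, LinearMap.ker_comp, Submodule.ker_mkQ,
      ← Submodule.disjoint_iff_comap_eq_bot]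
    exact (hN.disjoint.mono_left hK).symm
  obtain ⟨K', hK'⟩ := hM (p.map N.subtype)
    ⟨((p.map N.subtype).mkQ ∘ₗ N'.subtype) ∘ₗ
      (Submodule.quotientEquivOfIsCompl N N' hN).toLinearMap ∘ₗ f,
      hg.comp ((Submodule.quotientEquivOfIsCompl N N' hN).injective.comp hf)⟩
  refine ⟨K'.comap N.subtype, ?_⟩
  have := Submodule.isCompl_comap_subtype_of_isCompl_of_le hK' hK
  rwa [Submodule.comap_map_eq_of_injective N.subtype_injective] at this

/-- The elementwise form of primeness. -/
theorem exists_mul_mul_ne_zero_of_prime {A : Type*} [Ring A]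
    (hprime : ∀ B C : TwoSidedIdeal A, B ≠ ⊥ → C ≠ ⊥ → ∃ b ∈ B, ∃ c ∈ C, b * c ≠ 0)
    {x y : A} (hx : x ≠ 0) (hy : y ≠ 0) : ∃ a, x * a * y ≠ 0 := by
  by_contra! h
  let C : TwoSidedIdeal A := .mk' {c | ∀ a, x * a * c = 0} (by simp)
    (fun hc hd a ↦ by rw [mul_add, hc a, hd a, add_zero])
    (fun hc a ↦ by rw [mul_neg, hc a, neg_zero])
    (fun {b c} hc a ↦ by rw [← mul_assoc, mul_assoc x, hc])
    (fun {c b} hc a ↦ by rw [← mul_assoc, hc, zero_mul])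
  let B : TwoSidedIdeal A := .mk' {b | ∀ c ∈ C, ∀ a, b * a * c = 0} (by simp)
    (fun hb hd c hc a ↦ by rw [add_mul, add_mul, hb c hc a, hd c hc a, add_zero])
    (fun hb c hc a ↦ by rw [neg_mul, neg_mul, hb c hc a, neg_zero])
    (fun {d b} hb c hc a ↦ by rw [mul_assoc d, mul_assoc d, hb c hc, mul_zero])
    (fun {b d} hb c hc a ↦ by rw [mul_assoc b, hb c hc])
  have hyC : y ∈ C := (TwoSidedIdeal.mem_mk' ..).2 h
  have hxB : x ∈ B := (TwoSidedIdeal.mem_mk' ..).2 fun c hc ↦ (TwoSidedIdeal.mem_mk' ..).1 hc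
  obtain ⟨b, hb, c, hc, hbc⟩ := hprime B C
    (fun h0 ↦ hx ((TwoSidedIdeal.mem_bot A).1 (h0 ▸ hxB)))
    (fun h0 ↦ hy ((TwoSidedIdeal.mem_bot A).1 (h0 ▸ hyC)))
  have := (TwoSidedIdeal.mem_mk' ..).1 hb c hc 1
  rw [mul_one] at this
  exact hbc this

open scoped IsSimpleOrder in
/-- A simple module is artinian. -/
theorem IsSimpleModule.isArtinian (R M : Type*) [Ring R] [AddCommGroup M] [Module R M]
    [IsSimpleModule R M] : IsArtinian R M :=
  inferInstance

/-- In a right finite-dimensional ring, the homogeneous component of a simple right ideal is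
artinian. -/
theorem isArtinian_isotypicComponent {A : Type u} [Ring A]
    (hfd : ∀ (ι : Type u) (f : ι → Submodule Aᵐᵒᵖ A),
      iSupIndep f → (∀ i, f i ≠ ⊥) → Finite ι)
    (S : Submodule Aᵐᵒᵖ A) [IsSimpleModule Aᵐᵒᵖ S] :
    IsArtinian Aᵐᵒᵖ (isotypicComponent Aᵐᵒᵖ A S) := by
  have hT : sSup {a ≤ isotypicComponent Aᵐᵒᵖ A S | IsAtom a} = isotypicComponent Aᵐᵒᵖ A S := by
    refine le_antisymm (sSup_le fun a ha ↦ ha.1) (sSup_le fun m hm ↦ le_sSup ⟨le_sSup hm, ?_⟩)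
    obtain ⟨e⟩ := hm
    exact isSimpleModule_iff_isAtom.1 (.congr e)
  obtain ⟨s, hs, hsup, hatom⟩ := exists_sSupIndep_of_sSup_atoms _ hT
  have : Finite s := hfd s (↑) ((sSupIndep_iff s).1 hs) fun i ↦ (hatom i.2).1
  have (i : s) : IsArtinian Aᵐᵒᵖ i.1 :=
    have := isSimpleModule_iff_isAtom.2 (hatom i.2)
    IsSimpleModule.isArtinian Aᵐᵒᵖ i.1
  rw [← hsup, sSup_eq_iSup']
  infer_instance

/-- A right finite-dimensional prime ring with a simple right ideal is right artinian. -/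
theorem isArtinian_of_isSimpleModule {A : Type u} [Ring A]
    (hprime : ∀ B C : TwoSidedIdeal A, B ≠ ⊥ → C ≠ ⊥ → ∃ b ∈ B, ∃ c ∈ C, b * c ≠ 0)
    (hfd : ∀ (ι : Type u) (f : ι → Submodule Aᵐᵒᵖ A),
      iSupIndep f → (∀ i, f i ≠ ⊥) → Finite ι)
    (S : Submodule Aᵐᵒᵖ A) [IsSimpleModule Aᵐᵒᵖ S] : IsArtinian Aᵐᵒᵖ A := by
  classical
  obtain ⟨s₀, hs₀, hs₀0⟩ := S.ne_bot_iff.1 (isSimpleModule_iff_isAtom.1 ‹_›).1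
  set T := isotypicComponent Aᵐᵒᵖ A S
  have hTart : IsArtinian Aᵐᵒᵖ T := isArtinian_isotypicComponent hfd S
  have hTleft (a : A) {t : A} (ht : t ∈ T) : a * t ∈ T :=
    Submodule.IsFullyInvariant.isotypicComponent Aᵐᵒᵖ A S (orbitMap a) ht
  have hTright {t : A} (ht : t ∈ T) (a : A) : t * a ∈ T := T.smul_mem (op a) ht
  let g (F : Finset S) : A →ₗ[Aᵐᵒᵖ] (F → S) := LinearMap.pi fun s ↦ orbitMap s.1
  have hg (F : Finset S) (a : A) : g F a = 0 ↔ ∀ s ∈ F, (s : A) * a = 0 := by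
    rw [funext_iff, Subtype.forall]
    exact forall₂_congr fun s _ ↦ Subtype.ext_iff
  obtain ⟨_, ⟨F, rfl⟩, hF⟩ := IsArtinian.set_has_minimal
    (Set.range fun F : Finset S ↦ (LinearMap.ker (g F)).comap T.subtype) (Set.range_nonempty _)
  have hFT {t : A} (ht : t ∈ T) (h : g F t = 0) : t = 0 := by
    by_contra ht0
    obtain ⟨a, ha⟩ := exists_mul_mul_ne_zero_of_prime hprime hs₀0 ht0
    let s : S := ⟨s₀ * a, S.smul_mem (op a) hs₀⟩
    refine hF _ ⟨insert s F, rfl⟩ (lt_of_le_not_ge (fun x hx ↦ ?_) fun hle ↦ ?_)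
    · exact (hg F x).2 fun r hr ↦ (hg _ x).1 hx r (Finset.mem_insert_of_mem hr)
    · exact ha ((hg _ t).1 (hle (x := ⟨t, ht⟩) h) s (Finset.mem_insert_self s F))
  have := IsSimpleModule.isArtinian Aᵐᵒᵖ S
  refine isArtinian_of_injective (g F) ((injective_iff_map_eq_zero _).2 fun x hx ↦ ?_)
  by_contra hx0
  obtain ⟨a, ha⟩ := exists_mul_mul_ne_zero_of_prime hprime hx0 hs₀0
  refine ha (hFT (hTleft _ (S.le_isotypicComponent hs₀)) ((hg F _).2 fun s hs ↦ ?_))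
  rw [← mul_assoc, ← mul_assoc, (hg F x).1 hx s hs, zero_mul, zero_mul]

/-- If `A` is a right finite-dimensional prime ring which is not right artinian, then
every generalized bassian non-singular right `A`-module is bassian. -/
theorem stmt12 {A : Type u} [Ring A]
    (hprime : ∀ B C : TwoSidedIdeal A, B ≠ ⊥ → C ≠ ⊥ → ∃ b ∈ B, ∃ c ∈ C, b * c ≠ 0)
    (hfd : ∀ (ι : Type u) (f : ι → Submodule Aᵐᵒᵖ A),
      iSupIndep f → (∀ i, f i ≠ ⊥) → Finite ι)
    (hnotart : ¬ IsArtinian Aᵐᵒᵖ A)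
    (M : Type v) [AddCommGroup M] [Module Aᵐᵒᵖ M]
    (hM : IsGeneralizedBassian Aᵐᵒᵖ M) (hns : singularSet A M = {0}) :
    IsBassian Aᵐᵒᵖ M := by
  rintro N ⟨f, hf⟩
  by_contra hN
  have := hM.isSemisimpleModule hf
  obtain ⟨P, -, hP⟩ := (IsSemisimpleModule.eq_bot_or_exists_simple_le N).resolve_left hN
  obtain ⟨m, hmP, hm0⟩ := P.ne_bot_iff.1 (isSimpleModule_iff_isAtom.1 hP).1
  have hm : ¬ IsEssentialSubmodule (rightAnnihilator A m) := fun h ↦ by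
    have : m ∈ singularSet A M := h
    rw [hns] at this
    exact hm0 this
  unfold IsEssentialSubmodule at hm
  push Not at hm
  obtain ⟨Y, hY, hYm⟩ := hm
  let φ : Y →ₗ[Aᵐᵒᵖ] P := orbitMap (⟨m, hmP⟩ : P) ∘ₗ Y.subtype
  have hφ : Function.Injective φ := (injective_iff_map_eq_zero _).2 fun y hy ↦ by
    have : (y : A) ∈ rightAnnihilator A m ⊓ Y := ⟨congrArg Subtype.val hy, y.2⟩
    rw [hYm] at this
    exact Subtype.ext this
  have hφ0 : φ ≠ 0 := fun h ↦ by
    obtain ⟨y, hy, hy0⟩ := Y.ne_bot_iff.1 hY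
    exact hy0 (congrArg Subtype.val (hφ (a₁ := ⟨y, hy⟩) (a₂ := 0) (by simp [h])))
  have : IsSimpleModule Aᵐᵒᵖ Y :=
    .congr (LinearEquiv.ofBijective φ ⟨hφ, φ.surjective_of_ne_zero hφ0⟩)
  exact hnotart (isArtinian_of_isSimpleModule hprime hfd Y)
end
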